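/- Let U be a unitary operator on a finite-dimensional Hilbert space H, P an orthogonal projection with P ≠ I, and suppose U has an eigenvector in the range of P. Then for every ε > 0 there exists a unitary U' with ‖U − U'‖ < ε such that no eigenvector of U' lies in the range of P. -/

import Mathlib

open ContinuousLinearMap

namespace LinearIsometry

open Module End

variable {E : Type*} [NormedAddCommGroup E] [InnerProductSpace ℂ E] (f : E →ₗᵢ[ℂ] E)

/-- The eigenvalues of an isometry have modulus one. -/
theorem norm_eigenvalue {μ : ℂ} {v : E} (hv : f v = μ • v) (hv₀ : v ≠ 0) : ‖μ‖ = 1 := by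
  have h := f.norm_map v
  rw [hv, norm_smul] at h
  exact (mul_eq_right₀ (norm_ne_zero_iff.mpr hv₀)).mp h

/-- The eigenspaces of an isometry are mutually orthogonal. -/
theorem orthogonalFamily_eigenspaces :
    OrthogonalFamily ℂ (fun μ => eigenspace f.toLinearMap μ)
      fun μ => (eigenspace f.toLinearMap μ).subtypeₗᵢ := by
  rintro μ ν hμν ⟨v, hv⟩ ⟨w, hw⟩
  rw [mem_eigenspace_iff] at hv hw
  change inner ℂ v w = 0
  by_cases hv₀ : v = 0
  · simp [hv₀]
  have hμ : μ * starRingEnd ℂ μ = 1 := by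
    simp [Complex.mul_conj', f.norm_eigenvalue hv hv₀]
  have h := f.inner_map_map v w
  simp only [coe_toLinearMap] at hv hw
  rw [hv, hw, inner_smul_left, inner_smul_right] at h
  have h₂ : (ν - μ) * inner ℂ v w = 0 := by
    linear_combination μ * h - ν * inner ℂ v w * hμ
  exact (mul_eq_zero.mp h₂).resolve_left (sub_ne_zero.mpr hμν.symm)

/-- An isometry preserves the orthogonal complement of each of its eigenspaces. -/
theorem invariant_orthogonalComplement_eigenspace (μ : ℂ) (v : E)
    (hv : v ∈ (eigenspace f.toLinearMap μ)ᗮ) : f v ∈ (eigenspace f.toLinearMap μ)ᗮ := by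
  intro w hw
  by_cases hw₀ : w = 0
  · simp [hw₀]
  have hfw : f w = μ • w := by simpa [mem_eigenspace_iff] using hw
  have hμ : μ ≠ 0 := by
    rintro rfl
    simpa using f.norm_eigenvalue hfw hw₀
  have h := f.inner_map_map w v
  rw [hv w hw, hfw, inner_smul_left] at h
  exact (mul_eq_zero.mp h).resolve_left (by simpa using hμ)

variable [FiniteDimensional ℂ E]

/-- The eigenspaces of an isometry of a finite-dimensional complex space span the space. -/
theorem orthogonalComplement_iSup_eigenspaces_eq_bot :
    (⨆ μ, eigenspace f.toLinearMap μ)ᗮ = ⊥ := by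
  have hinv : ∀ v ∈ (⨆ μ, eigenspace f.toLinearMap μ)ᗮ,
      f.toLinearMap v ∈ (⨆ μ, eigenspace f.toLinearMap μ)ᗮ := by
    intro v hv
    rw [← Submodule.iInf_orthogonal] at hv ⊢
    exact f.toLinearMap.iInf_invariant f.invariant_orthogonalComplement_eigenspace v hv
  by_contra hne
  have : Nontrivial ((⨆ μ, eigenspace f.toLinearMap μ)ᗮ : Submodule ℂ E) :=
    Submodule.nontrivial_iff_ne_bot.mpr hne
  obtain ⟨μ, hμ⟩ := exists_eigenvalue (f.toLinearMap.restrict hinv)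
  refine hμ (eigenspace_restrict_eq_bot hinv ?_)
  exact ((Submodule.isOrtho_orthogonal_right _).mono_left
    (le_iSup (eigenspace f.toLinearMap) μ)).disjoint

/-- An isometry of a finite-dimensional complex space has an orthonormal eigenbasis. -/
theorem exists_orthonormalBasis_eigenvectors :
    ∃ (b : OrthonormalBasis (Fin (finrank ℂ E)) ℂ E) (l : Fin (finrank ℂ E) → ℂ),
      ∀ i, f (b i) = l i • b i := by
  classical
  have hV : OrthogonalFamily ℂ (fun μ : Eigenvalues f.toLinearMap => eigenspace f.toLinearMap μ)
      fun μ => (eigenspace f.toLinearMap μ).subtypeₗᵢ :=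
    f.orthogonalFamily_eigenspaces.comp Subtype.coe_injective
  have hint : DirectSum.IsInternal
      fun μ : Eigenvalues f.toLinearMap => eigenspace f.toLinearMap μ := by
    refine hV.isInternal_iff.mpr ?_
    change (⨆ μ : { μ // eigenspace f.toLinearMap μ ≠ ⊥ }, eigenspace f.toLinearMap μ)ᗮ = ⊥
    rw [iSup_ne_bot_subtype, f.orthogonalComplement_iSup_eigenspaces_eq_bot]
  refine ⟨hint.subordinateOrthonormalBasis rfl hV,
    fun i => (hint.subordinateOrthonormalBasisIndex rfl i hV).val, fun i => ?_⟩
  exact mem_eigenspace_iff.mp (hint.subordinateOrthonormalBasis_subordinate rfl i hV)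

end LinearIsometry

/-- Every neighbourhood of `1` contains infinitely many complex numbers of modulus one. -/
theorem Complex.infinite_norm_eq_one_norm_sub_one_lt {δ : ℝ} (hδ : 0 < δ) :
    {z : ℂ | ‖z‖ = 1 ∧ ‖z - 1‖ < δ}.Infinite := by
  have hinj : Set.InjOn (fun t : ℝ => (Circle.exp t : ℂ)) (Set.Ioo 0 (min δ 1)) := by
    intro s hs t ht hst
    have hpi := Real.pi_gt_three
    have key : ∀ u ∈ Set.Ioo 0 (min δ 1), Complex.arg (Circle.exp u) = u := fun u hu =>
      Circle.arg_exp (by linarith [hu.1]) (by linarith [hu.2, min_le_right δ 1])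
    rw [← key s hs, ← key t ht]
    exact congrArg Complex.arg hst
  refine ((Set.Ioo_infinite (lt_min hδ one_pos)).image hinj).mono ?_
  rintro _ ⟨t, ht, rfl⟩
  refine ⟨Circle.norm_coe _, ?_⟩
  have h := Real.norm_exp_I_mul_ofReal_sub_one_le (x := t)
  rw [mul_comm] at h
  refine h.trans_lt ?_
  rw [Real.norm_of_nonneg ht.1.le]
  exact ht.2.trans_le (min_le_left _ _)

/-- Finitely many infinite sets have a system of distinct representatives. -/
theorem Set.exists_injective_forall_mem_of_infinite {ι α : Type*} [Fintype ι] {s : ι → Set α}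
    (hs : ∀ i, (s i).Infinite) : ∃ g : ι → α, Function.Injective g ∧ ∀ i, g i ∈ s i := by
  classical
  choose t hts htc using fun i => (hs i).exists_subset_card_eq (Fintype.card ι)
  obtain ⟨g, hg, hgt⟩ := (Finset.all_card_le_biUnion_card_iff_exists_injective t).mp fun r => by
    rcases r.eq_empty_or_nonempty with rfl | ⟨i, hi⟩
    · simp
    · calc r.card ≤ Fintype.card ι := r.card_le_univ
        _ = (t i).card := (htc i).symm
        _ ≤ _ := Finset.card_le_card (Finset.subset_biUnion_of_mem t hi)
  exact ⟨g, hg, fun i => hts i (hgt i)⟩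

namespace OrthonormalBasis

variable {ι E : Type*} [Fintype ι] [NormedAddCommGroup E] [InnerProductSpace ℂ E]

/-- An orthonormal basis and a vector have a common vector orthogonal to none of them. -/
theorem exists_inner_ne_zero (b : OrthonormalBasis ι ℂ E) {w : E} (hw : w ≠ 0) :
    ∃ x : E, inner ℂ w x ≠ 0 ∧ ∀ i, inner ℂ x (b i) ≠ 0 := by
  classical
  let c : ι → ℂ := fun i => if inner ℂ (b i) w = 0 then 1 else inner ℂ (b i) w
  have hx : ∀ i, inner ℂ (b i) (∑ j, c j • b j) = c i := fun i =>
    b.orthonormal.inner_right_fintype c i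
  refine ⟨∑ i, c i • b i, ?_, fun i => ?_⟩
  · rw [← b.sum_inner_mul_inner]
    have h : ∀ i, inner ℂ w (b i) * inner ℂ (b i) (∑ j, c j • b j)
        = ((‖inner ℂ (b i) w‖ ^ 2 : ℝ) : ℂ) := by
      intro i
      rw [hx, ← inner_conj_symm w (b i)]
      by_cases h₀ : inner ℂ (b i) w = 0
      · simp [h₀]
      · simp only [c, if_neg h₀, Complex.conj_mul', Complex.ofReal_pow]
    simp_rw [h]
    rw [← Complex.ofReal_sum, b.sum_sq_norm_inner_right]
    simpa using hw
  · rw [← inner_conj_symm, hx, Ne, map_eq_zero]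
    by_cases h₀ : inner ℂ (b i) w = 0 <;> simp [c, h₀]

/-- The coordinates of the image of a vector under an operator that is diagonal in an orthonormal
basis. -/
theorem inner_apply_of_apply_eq_smul (b : OrthonormalBasis ι ℂ E) {S : E →L[ℂ] E} {k : ι → ℂ}
    (hS : ∀ i, S (b i) = k i • b i) (i : ι) (v : E) :
    inner ℂ (b i) (S v) = k i * inner ℂ (b i) v := by
  classical
  conv_lhs => rw [← b.sum_repr' v]
  simp [map_sum, hS, b.inner_eq_ite, mul_comm]

/-- If two operators are diagonal in an orthonormal basis, the distance between them is bounded by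
the distances between their eigenvalues. -/
theorem opNorm_sub_le_of_apply_eq_smul (b : OrthonormalBasis ι ℂ E) {S T : E →L[ℂ] E}
    {k l : ι → ℂ} (hS : ∀ i, S (b i) = k i • b i) (hT : ∀ i, T (b i) = l i • b i) {δ : ℝ}
    (hδ : 0 ≤ δ) (h : ∀ i, ‖k i - l i‖ ≤ δ) : ‖S - T‖ ≤ δ := by
  refine opNorm_le_bound _ hδ fun v => ?_
  have hc : ∀ i, inner ℂ (b i) ((S - T) v) = (k i - l i) * inner ℂ (b i) v := by
    intro i
    rw [sub_apply, inner_sub_right, b.inner_apply_of_apply_eq_smul hS,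
      b.inner_apply_of_apply_eq_smul hT, sub_mul]
  refine le_of_sq_le_sq ?_ (by positivity)
  rw [← b.sum_sq_norm_inner_right, mul_pow, ← b.sum_sq_norm_inner_right v, Finset.mul_sum]
  refine Finset.sum_le_sum fun i _ => ?_
  rw [hc, norm_mul, mul_pow]
  gcongr
  exact h i

variable [FiniteDimensional ℂ E]

/-- Prescribing eigenvalues of modulus one on an orthonormal basis defines a unitary operator. -/
theorem exists_unitary_apply_eq_smul (b : OrthonormalBasis ι ℂ E) {l : ι → ℂ}
    (hl : ∀ i, ‖l i‖ = 1) :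
    ∃ D ∈ unitary (E →L[ℂ] E), ∀ i, D (b i) = l i • b i := by
  classical
  let T : (ι → ℂ) → E →L[ℂ] E := fun c =>
    LinearMap.toContinuousLinearMap (b.toBasis.constr ℂ fun i => c i • b i)
  have hT : ∀ c i, T c (b i) = c i • b i := fun c i => by
    have h := b.toBasis.constr_basis ℂ (fun i => c i • b i) i
    rwa [b.coe_toBasis] at h
  have hstar : star (T l) = T fun i => starRingEnd ℂ (l i) := by
    refine ContinuousLinearMap.coe_injective (b.toBasis.ext fun i => ext_inner_right ℂ fun v => ?_)
    simp [star_eq_adjoint, adjoint_inner_left, hT, inner_smul_left,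
      b.inner_apply_of_apply_eq_smul (hT l)]
  refine ⟨T l, ⟨?_, ?_⟩, hT l⟩
  all_goals
    rw [hstar]
    apply ContinuousLinearMap.coe_injective
    refine b.toBasis.ext fun i => ?_
    simp [hT, smul_smul, Complex.mul_conj', Complex.conj_mul', hl]

end OrthonormalBasis

/-- For an orthogonal projection `q` and `‖z‖ = 1`, the operator acting as `z` on the range of `q`
and as the identity on its orthogonal complement is unitary. -/
theorem IsStarProjection.one_add_smul_mem_unitary {A : Type*} [Ring A] [StarRing A] [Algebra ℂ A]
    [StarModule ℂ A] {q : A} (hq : IsStarProjection q) {z : ℂ} (hz : ‖z‖ = 1) :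
    1 + (z - 1) • q ∈ unitary A := by
  have hzz : z * starRingEnd ℂ z = 1 := by simp [Complex.mul_conj', hz]
  have hqq : q * q = q := hq.isIdempotentElem
  have hs : star (1 + (z - 1) • q) = 1 + (starRingEnd ℂ z - 1) • q := by
    simp [hq.isSelfAdjoint.star_eq]
  rw [Unitary.mem_iff, hs]
  constructor
  all_goals
    simp only [mul_add, add_mul, one_mul, mul_one, smul_mul_smul_comm, hqq, add_assoc, ← add_smul]
    rw [add_eq_left]
    convert zero_smul ℂ q using 2
    linear_combination hzz

/-- An orthonormal basis can be moved by a unitary arbitrarily close to the identity so that none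
of its vectors is orthogonal to a given nonzero vector. -/
theorem OrthonormalBasis.exists_unitary_inner_apply_ne_zero {ι E : Type*} [Fintype ι]
    [NormedAddCommGroup E] [InnerProductSpace ℂ E] [FiniteDimensional ℂ E]
    (b : OrthonormalBasis ι ℂ E) {w : E} (hw : w ≠ 0) {δ : ℝ} (hδ : 0 < δ) :
    ∃ W ∈ unitary (E →L[ℂ] E), ‖W - 1‖ < δ ∧ ∀ i, inner ℂ w (W (b i)) ≠ 0 := by
  obtain ⟨x, hwx, hxb⟩ := b.exists_inner_ne_zero hw
  have hx₀ : x ≠ 0 := by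
    rintro rfl
    simp at hwx
  let Q : E →L[ℂ] E := (ℂ ∙ x).starProjection
  have hQ : ∀ i, inner ℂ w (Q (b i)) ≠ 0 := fun i => by
    simp [Q, Submodule.starProjection_singleton, hwx, hxb i, hx₀]
  have hfin : (Set.range fun i => 1 - inner ℂ w (b i) / inner ℂ w (Q (b i))).Finite :=
    Set.finite_range _
  obtain ⟨z, ⟨hz, hzδ⟩, hzb⟩ :=
    ((Complex.infinite_norm_eq_one_norm_sub_one_lt hδ).sdiff hfin).nonempty
  refine ⟨1 + (z - 1) • Q, isStarProjection_starProjection.one_add_smul_mem_unitary hz, ?_,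
    fun i hi => hzb ⟨i, ?_⟩⟩
  · rw [add_sub_cancel_left, norm_smul]
    exact (mul_le_of_le_one_right (norm_nonneg _)
      (Submodule.starProjection_norm_le _)).trans_lt hzδ
  · have h : inner ℂ w (b i) + (z - 1) * inner ℂ w (Q (b i)) = 0 := by
      simpa [inner_add_right, inner_smul_right] using hi
    have := hQ i
    field_simp
    linear_combination -h

/-- If `D` is diagonal with distinct eigenvalues in an orthonormal basis, each of its eigenvectors
is a multiple of a basis vector. -/
theorem OrthonormalBasis.exists_eq_smul_of_apply_eq_smul {ι E : Type*} [Fintype ι]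
    [NormedAddCommGroup E] [InnerProductSpace ℂ E] (b : OrthonormalBasis ι ℂ E) {D : E →L[ℂ] E}
    {l : ι → ℂ} (hl : Function.Injective l) (hD : ∀ i, D (b i) = l i • b i) {u : E} (hu₀ : u ≠ 0)
    {μ : ℂ} (hu : D u = μ • u) : ∃ (i : ι) (c : ℂ), c ≠ 0 ∧ u = c • b i := by
  have hc : ∀ i, l i = μ ∨ inner ℂ (b i) u = 0 := fun i => by
    have h := b.inner_apply_of_apply_eq_smul hD i u
    rw [hu, inner_smul_right] at h
    exact mul_eq_mul_right_iff.mp h.symm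
  obtain ⟨i, hi⟩ : ∃ i, inner ℂ (b i) u ≠ 0 := by
    by_contra! h
    exact hu₀ (by rw [← b.sum_repr' u]; simp [h])
  refine ⟨i, inner ℂ (b i) u, hi, ?_⟩
  conv_lhs => rw [← b.sum_repr' u]
  refine Fintype.sum_eq_single i fun j hj => ?_
  rw [(hc j).resolve_left fun h => hj (hl (h.trans ((hc i).resolve_right hi).symm)), zero_smul]

/-- A small disturbance of a unitary `U` can remove all of its eigenvectors
from the range of a proper orthogonal projection `P`. -/
theorem stmt_18 {H : Type*} [NormedAddCommGroup H] [InnerProductSpace ℂ H]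
    [FiniteDimensional ℂ H]
    (U P : H →L[ℂ] H)
    (hU₁ : adjoint U ∘L U = 1) (hU₂ : U ∘L adjoint U = 1)
    (hP : P ∘L P = P) (hPsa : adjoint P = P) (hPne : P ≠ 1)
    (hex : ∃ v : H, v ≠ 0 ∧ (∃ μ : ℂ, U v = μ • v) ∧ P v = v) :
    ∀ ε > (0 : ℝ), ∃ U' : H →L[ℂ] H,
      adjoint U' ∘L U' = 1 ∧ U' ∘L adjoint U' = 1 ∧ ‖U - U'‖ < ε ∧
      ∀ v : H, v ≠ 0 → (∃ μ : ℂ, U' v = μ • v) → P v ≠ v := by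
  intro ε hε
  have hε₃ : 0 < ε / 3 := by positivity
  obtain ⟨y, hy⟩ : ∃ y, P y ≠ y := by
    by_contra! h
    exact hPne (ContinuousLinearMap.ext h)
  have hw : y - P y ≠ 0 := sub_ne_zero.mpr hy.symm
  have hPw : P (y - P y) = 0 := by
    rw [map_sub, ← comp_apply, hP, sub_self]
  set w := y - P y
  have hU : U ∈ unitary (H →L[ℂ] H) := ⟨hU₁, hU₂⟩
  have hnorm : ∀ v, ‖U v‖ = ‖v‖ := (norm_map_iff_adjoint_comp_self U).mpr hU₁
  obtain ⟨b, k, hk⟩ :=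
    (⟨U.toLinearMap, hnorm⟩ : H →ₗᵢ[ℂ] H).exists_orthonormalBasis_eigenvectors
  replace hk : ∀ i, U (b i) = k i • b i := hk
  have hk₁ : ∀ i, ‖k i‖ = 1 := fun i => by
    simpa [hk, norm_smul] using hnorm (b i)
  obtain ⟨l, hl, hlk⟩ : ∃ l : Fin (Module.finrank ℂ H) → ℂ, Function.Injective l ∧
      ∀ i, l i ∈ (k i * ·) '' {z : ℂ | ‖z‖ = 1 ∧ ‖z - 1‖ < ε / 3} := by
    refine Set.exists_injective_forall_mem_of_infinite fun i =>
      (Complex.infinite_norm_eq_one_norm_sub_one_lt hε₃).image ?_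
    exact (mul_right_injective₀ (norm_ne_zero_iff.mp (by simp [hk₁]))).injOn
  choose z hz hzl using hlk
  have hl₁ : ∀ i, ‖l i‖ = 1 := fun i => by
    rw [← hzl i, norm_mul, hk₁, (hz i).1, one_mul]
  have hkl : ∀ i, ‖k i - l i‖ ≤ ε / 3 := fun i => by
    have h : k i - l i = -(k i * (z i - 1)) := by
      rw [← hzl i]
      ring
    rw [h, norm_neg, norm_mul, hk₁, one_mul]
    exact (hz i).2.le
  obtain ⟨D, hD, hDb⟩ := b.exists_unitary_apply_eq_smul hl₁
  obtain ⟨W, hW, hW₁, hWb⟩ := b.exists_unitary_inner_apply_ne_zero hw hε₃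
  have hU' : W * D * star W ∈ unitary (H →L[ℂ] H) :=
    mul_mem (mul_mem hW hD) (Unitary.star_mem hW)
  refine ⟨W * D * star W, hU'.1, hU'.2, ?_, ?_⟩
  · have hUD := b.opNorm_sub_le_of_apply_eq_smul hk hDb hε₃.le hkl
    have hDW : ‖U - W * D * star W‖ = ‖(U - D) * W - (W - 1) * D + D * (W - 1)‖ := by
      rw [← CStarRing.norm_mul_mem_unitary (U - W * D * star W) hW, sub_mul, mul_assoc (W * D),
        hW.1]
      congr 1
      noncomm_ring
    calc ‖U - W * D * star W‖
        ≤ ‖(U - D) * W‖ + ‖(W - 1) * D‖ + ‖D * (W - 1)‖ :=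
          hDW ▸ (norm_add_le _ _).trans (by gcongr; exact norm_sub_le _ _)
      _ = ‖U - D‖ + ‖W - 1‖ + ‖W - 1‖ := by
          rw [CStarRing.norm_mul_mem_unitary _ hW, CStarRing.norm_mul_mem_unitary _ hD,
            CStarRing.norm_mem_unitary_mul _ hD]
      _ < ε := by linarith
  · rintro v hv₀ ⟨μ, hv⟩ hPv
    have hWW : ∀ a, W (star W a) = a := fun a => congrArg (fun T : H →L[ℂ] H => T a) hW.2
    have hWW' : ∀ a, star W (W a) = a := fun a => congrArg (fun T : H →L[ℂ] H => T a) hW.1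
    have hu₀ : star W v ≠ 0 := fun h => hv₀ (by rw [← hWW v, h, map_zero])
    have hu : D (star W v) = μ • star W v := by
      rw [← map_smul, ← hv]
      exact (hWW' _).symm
    obtain ⟨i, c, hc, hi⟩ := b.exists_eq_smul_of_apply_eq_smul hl hDb hu₀ hu
    have hwv : inner ℂ w v = 0 := by
      rw [← hPv, ← adjoint_inner_left, hPsa, hPw, inner_zero_left]
    rw [← hWW v, hi, map_smul, inner_smul_right] at hwv
    exact (mul_ne_zero hc (hWb i)) hwv
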